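/- Let (A,≻,≺) be an anti-dendriform algebra over a field k and r ∈ A⊗A a skew-symmetric element (τ(r) = -r, where τ is the flip). Let T_r: A* → A be defined by T_r(w*) = Σᵢ ⟨w*, aᵢ⟩bᵢ for r = Σᵢ aᵢ⊗bᵢ. Then r satisfies the anti-dendriform Yang-Baxter equation r₁₂·r₁₃ + r₂₃≻r₁₂ - r₁₃≺r₂₃ = 0 if and only if T_r(u*)·T_r(v*) + T_r(R_≺*(T_r(u*))v* + L_≻*(T_r(v*))u*) = 0 for all u*, v* ∈ A*, where · = ≻+≺, and R_≺*, L_≻* are the duals of right multiplication by ≺ and left multiplication by ≻. -/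

import Mathlib

open scoped TensorProduct

/-- An anti-dendriform algebra structure given by bundled bilinear operations
`s` (≻) and `p` (≺). -/
def IsADAlgL (k : Type*) [Field k] {A : Type*} [AddCommGroup A] [Module k A]
    (s p : A →ₗ[k] A →ₗ[k] A) : Prop :=
  (∀ x y z, s x (s y z) = - s (s x y + p x y) z) ∧
  (∀ x y z, s x (s y z) = - p x (s y z + p y z)) ∧
  (∀ x y z, s x (s y z) = p (p x y) z) ∧
  (∀ x y z, p (s x y) z = s x (p y z))

/-- The linear map `A* → A` associated to `r = ∑ i, a i ⊗ b i`. -/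
def Tmap (k : Type*) [Field k] {A : Type*} [AddCommGroup A] [Module k A]
    {ι : Type*} [Fintype ι] (a b : ι → A) (w : Module.Dual k A) : A :=
  ∑ i, w (a i) • b i

/-- Evaluation of a triple tensor on three functionals. -/
noncomputable def triEval {k A : Type*} [Field k] [AddCommGroup A] [Module k A]
    (x y z : Module.Dual k A) : A ⊗[k] (A ⊗[k] A) →ₗ[k] k :=
  LinearMap.mul' k k ∘ₗ TensorProduct.map x (LinearMap.mul' k k ∘ₗ TensorProduct.map y z)

theorem triEval_tmul {k A : Type*} [Field k] [AddCommGroup A] [Module k A]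
    (x y z : Module.Dual k A) (a b c : A) :
    triEval x y z (a ⊗ₜ[k] (b ⊗ₜ[k] c)) = x a * (y b * z c) := by
  simp [triEval]

theorem triEval_sep {k A : Type*} [Field k] [AddCommGroup A] [Module k A]
    [FiniteDimensional k A] (t : A ⊗[k] (A ⊗[k] A)) :
    t = 0 ↔ ∀ x y z : Module.Dual k A, triEval x y z t = 0 := by
  constructor
  · rintro rfl x y z
    simp
  · intro h
    let e := Module.finBasis k A
    let E := e.tensorProduct (e.tensorProduct e)
    apply E.ext_elem
    rintro ⟨i, j, l⟩
    have key : E.coord (i, j, l) = triEval (e.coord i) (e.coord j) (e.coord l) := by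
      apply TensorProduct.ext'
      intro a bc
      induction bc using TensorProduct.induction_on with
      | zero => simp
      | tmul b c => simp [triEval_tmul, E, mul_comm, mul_left_comm]
      | add u v hu hv => rw [TensorProduct.tmul_add, map_add, map_add, hu, hv]
    have := LinearMap.congr_fun key t
    rw [h] at this
    simpa using this

theorem stmt9 {k A : Type*} [Field k] [AddCommGroup A] [Module k A]
    [FiniteDimensional k A] {ι : Type*} [Fintype ι]
    (s p : A →ₗ[k] A →ₗ[k] A) (hA : IsADAlgL k s p) (a b : ι → A)
    (hskew : (∑ i, a i ⊗ₜ[k] b i : A ⊗[k] A) = - ∑ i, b i ⊗ₜ[k] a i) :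
    -- r₁₂·r₁₃ + r₂₃≻r₁₂ - r₁₃≺r₂₃ = 0
    ((∑ i, ∑ j, (s (a i) (a j) + p (a i) (a j)) ⊗ₜ[k] (b i ⊗ₜ[k] b j))
      + (∑ i, ∑ j, a j ⊗ₜ[k] (s (a i) (b j) ⊗ₜ[k] b i))
      - (∑ i, ∑ j, a i ⊗ₜ[k] (a j ⊗ₜ[k] p (b i) (b j)))
      = (0 : A ⊗[k] (A ⊗[k] A)))
    ↔
    (∀ u v : Module.Dual k A,
      s (Tmap k a b u) (Tmap k a b v) + p (Tmap k a b u) (Tmap k a b v)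
        + Tmap k a b (v ∘ₗ p.flip (Tmap k a b u) + u ∘ₗ s (Tmap k a b v)) = 0) := by
  have hT : ∀ w : Module.Dual k A, (∑ i, w (b i) • a i) = - Tmap k a b w := by
    intro w
    have := congrArg ((TensorProduct.lid k A).toLinearMap ∘ₗ TensorProduct.map w LinearMap.id) hskew
    simp only [map_sum, map_neg, LinearMap.comp_apply, TensorProduct.map_tmul,
      LinearEquiv.coe_coe, TensorProduct.lid_tmul, LinearMap.id_apply] at this
    rw [Tmap, this, neg_neg]
  have hsw : ∀ w x : Module.Dual k A, w (Tmap k a b x) = - x (Tmap k a b w) := by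
    intro w x
    rw [← map_neg, ← hT w]
    simp [Tmap, mul_comm]
  have hsep : ∀ m : A, m = 0 ↔ ∀ w : Module.Dual k A, w m = 0 := fun m =>
    (Module.forall_dual_apply_eq_zero_iff k m).symm
  have h1 : ∀ x y z : Module.Dual k A,
      triEval x y z (∑ i, ∑ j, (s (a i) (a j) + p (a i) (a j)) ⊗ₜ[k] (b i ⊗ₜ[k] b j))
      = x (s (Tmap k a b y) (Tmap k a b z) + p (Tmap k a b y) (Tmap k a b z)) := by
    intro x y z
    rw [← neg_neg (Tmap k a b y), ← neg_neg (Tmap k a b z), ← hT, ← hT]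
    simp only [map_neg, LinearMap.neg_apply, neg_neg, map_sum, LinearMap.sum_apply, map_smul,
      LinearMap.smul_apply, triEval_tmul, map_add, smul_eq_mul, mul_neg, Finset.sum_neg_distrib,
      Finset.mul_sum]
    simp only [← Finset.sum_add_distrib]
    rw [Finset.sum_comm]
    refine Finset.sum_congr rfl fun i _ => Finset.sum_congr rfl fun j _ => ?_
    ring
  have h2 : ∀ x y z : Module.Dual k A,
      triEval x y z (∑ i, ∑ j, a j ⊗ₜ[k] (s (a i) (b j) ⊗ₜ[k] b i))
      = - y (s (Tmap k a b z) (Tmap k a b x)) := by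
    intro x y z
    rw [← neg_neg (Tmap k a b z), ← hT]
    simp only [Tmap, map_neg, LinearMap.neg_apply, neg_neg, map_sum, LinearMap.sum_apply, map_smul,
      LinearMap.smul_apply, triEval_tmul, smul_eq_mul, mul_neg, Finset.sum_neg_distrib, Finset.mul_sum]
    rw [Finset.sum_comm]
    refine Finset.sum_congr rfl fun i _ => Finset.sum_congr rfl fun j _ => ?_
    ring
  have h3 : ∀ x y z : Module.Dual k A,
      triEval x y z (∑ i, ∑ j, a i ⊗ₜ[k] (a j ⊗ₜ[k] p (b i) (b j)))
      = z (p (Tmap k a b x) (Tmap k a b y)) := by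
    intro x y z
    simp only [Tmap, map_sum, LinearMap.sum_apply, map_smul,
      LinearMap.smul_apply, triEval_tmul, smul_eq_mul, Finset.mul_sum]
    rw [Finset.sum_comm]
    refine Finset.sum_congr rfl fun i _ => Finset.sum_congr rfl fun j _ => ?_
    ring
  have h4 : ∀ x y z : Module.Dual k A,
      x (s (Tmap k a b y) (Tmap k a b z) + p (Tmap k a b y) (Tmap k a b z)
        + Tmap k a b (z ∘ₗ p.flip (Tmap k a b y) + y ∘ₗ s (Tmap k a b z)))
      = x (s (Tmap k a b y) (Tmap k a b z) + p (Tmap k a b y) (Tmap k a b z))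
        + - y (s (Tmap k a b z) (Tmap k a b x)) - z (p (Tmap k a b x) (Tmap k a b y)) := by
    intro x y z
    rw [map_add x (_ + _), hsw x]
    simp only [LinearMap.add_apply, LinearMap.comp_apply, LinearMap.flip_apply]
    ring
  rw [triEval_sep]
  simp only [map_sub, map_add (triEval _ _ _), h1, h2, h3, hsep, h4]
  exact ⟨fun h u v w => h w u v, fun h x y z => h y z x⟩
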